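/- Let N ≥ 4 and 1 < γ ≤ 2(N−1)/N. There is no global classical solution on [0,∞) of the N-dimensional Euler–Poisson equations without damping (β = 0) whose conserved total energy satisfies E < 0; i.e., every classical solution with E < 0 blows up in finite time. -/

import Mathlib

open MeasureTheory Real Filter
open scoped RealInnerProductSpace Topology

noncomputable section

/-- Euclidean space `ℝ^N`. -/
abbrev Euc (N : ℕ) := EuclideanSpace ℝ (Fin N)

/-- Divergence of a vector field on `ℝ^N`. -/
def ediv {N : ℕ} (v : Euc N → Euc N) (x : Euc N) : ℝ :=
  ∑ i, fderiv ℝ (fun y => v y i) x (EuclideanSpace.single i 1)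

/-- Partial derivative of a scalar field in the `i`-th coordinate direction. -/
def epartial {N : ℕ} (i : Fin N) (f : Euc N → ℝ) (x : Euc N) : ℝ :=
  fderiv ℝ f x (EuclideanSpace.single i 1)

/-- Green's function of the Poisson equation in `ℝ^N`:
`log |x|` for `N = 2` and `-|x|^(2-N)` for `N ≥ 3`. -/
def green (N : ℕ) (x : Euc N) : ℝ :=
  if N = 2 then Real.log ‖x‖ else -(‖x‖ ^ ((2 : ℝ) - (N : ℝ)))

/-- Gravitational potential `Φ(t,x) = g ∫ G(x-y) ρ(t,y) dy`. -/
def potential (N : ℕ) (g : ℝ) (ρ : ℝ → Euc N → ℝ) (t : ℝ) (x : Euc N) : ℝ :=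
  g * ∫ y, green N (x - y) * ρ t y

/-- A classical solution on `[0,T)` (with `T : EReal`, so `T = ⊤` means a global
solution) of the `N`-dimensional Euler–Poisson equations with pressure
`P = K ρ^γ`, damping constant `β` and gravitational constant `g`:
nonnegative `C¹` density `ρ`, `C¹` velocity `u`, with `ρ(t,·)` supported in a
fixed bounded open set `Ω`, satisfying the continuity and momentum equations
pointwise. -/
structure IsEPSolution (N : ℕ) (K γ β g : ℝ) (Ω : Set (Euc N)) (T : EReal)
    (ρ : ℝ → Euc N → ℝ) (u : ℝ → Euc N → Euc N) : Prop where
  rho_nonneg : ∀ t x, 0 ≤ ρ t x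
  rho_C1 : ContDiff ℝ 1 (fun p : ℝ × Euc N => ρ p.1 p.2)
  u_C1 : ContDiff ℝ 1 (fun p : ℝ × Euc N => u p.1 p.2)
  omega_open : IsOpen Ω
  omega_bounded : Bornology.IsBounded Ω
  support_subset : ∀ t : ℝ, 0 ≤ t → (t : EReal) < T → Function.support (ρ t) ⊆ Ω
  continuity_eq : ∀ t : ℝ, 0 ≤ t → (t : EReal) < T → ∀ x : Euc N,
    deriv (fun s => ρ s x) t + ediv (fun y => ρ t y • u t y) x = 0
  momentum_eq : ∀ t : ℝ, 0 ≤ t → (t : EReal) < T → ∀ x : Euc N, ∀ j : Fin N,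
    deriv (fun s => ρ s x * u s x j) t
      + (∑ i, epartial i (fun y => ρ t y * u t y i * u t y j) x)
      + epartial j (fun y => K * ρ t y ^ γ) x
      = -(ρ t x * epartial j (potential N g ρ t) x) - β * ρ t x * u t x j

/-- Total energy (case `γ > 1`):
`E(t) = ∫_Ω (½ ρ|u|² + P/(γ-1) + ½ ρΦ) dx` with `P = K ρ^γ`. -/
def energy (N : ℕ) (K γ g : ℝ) (Ω : Set (Euc N)) (ρ : ℝ → Euc N → ℝ)
    (u : ℝ → Euc N → Euc N) (t : ℝ) : ℝ :=
  ∫ x in Ω, ((1 / 2) * ρ t x * ‖u t x‖ ^ 2 + K * ρ t x ^ γ / (γ - 1)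
    + (1 / 2) * ρ t x * potential N g ρ t x)

/-- Isothermal total energy (case `γ = 1`, `P = Kρ`):
`E(t) = ∫_Ω (½ ρ|u|² + Kρ log ρ + ½ ρΦ) dx` (note `ρ log ρ = 0` where `ρ = 0`
since `Real.log 0 = 0`). -/
def energyIso (N : ℕ) (K g : ℝ) (Ω : Set (Euc N)) (ρ : ℝ → Euc N → ℝ)
    (u : ℝ → Euc N → Euc N) (t : ℝ) : ℝ :=
  ∫ x in Ω, ((1 / 2) * ρ t x * ‖u t x‖ ^ 2 + K * ρ t x * Real.log (ρ t x)
    + (1 / 2) * ρ t x * potential N g ρ t x)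

/-- Second inertia function `H(t) = ∫_Ω ρ(t,x)|x|² dx`. -/
def inertia (N : ℕ) (Ω : Set (Euc N)) (ρ : ℝ → Euc N → ℝ) (t : ℝ) : ℝ :=
  ∫ x in Ω, ρ t x * ‖x‖ ^ 2

/-- Maximal radius of the support of `ρ(t,·)`. -/
def maxRadius (N : ℕ) (ρ : ℝ → Euc N → ℝ) (t : ℝ) : ℝ :=
  sSup ((fun x : Euc N => ‖x‖) '' Function.support (ρ t))

theorem aux_conv_deriv {N : ℕ} {G r : Euc N → ℝ} (hG : LocallyIntegrable G volume)
    (hr : ContDiff ℝ 1 r) (hc : HasCompactSupport r) (x : Euc N) :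
    ∃ L : Euc N →L[ℝ] ℝ, HasFDerivAt (fun x => ∫ z, G z * r (x - z)) L x ∧
      ∀ v, L v = ∫ z, G z * fderiv ℝ r (x - z) v := by
  have h := hc.hasFDerivAt_convolution_right (ContinuousLinearMap.mul ℝ ℝ) hG hr x
  refine ⟨_, h, fun v => ?_⟩
  rw [convolution_precompR_apply _ hG (hc.fderiv ℝ) (hr.continuous_fderiv one_ne_zero)]
  rfl

theorem aux_conv_int {N : ℕ} {G r : Euc N → ℝ} (hG : LocallyIntegrable G volume)
    (hr : Continuous r) (hc : HasCompactSupport r) (x : Euc N) :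
    Integrable (fun z => G z * r (x - z)) :=
  hc.convolutionExists_right (ContinuousLinearMap.mul ℝ ℝ) hG hr x

theorem aux_conv_cont {N : ℕ} {G r : Euc N → ℝ} (hG : LocallyIntegrable G volume)
    (hr : Continuous r) (hc : HasCompactSupport r) :
    Continuous (fun x => ∫ z, G z * r (x - z)) :=
  hc.continuous_convolution_right (ContinuousLinearMap.mul ℝ ℝ) hG hr

theorem aux_conv_contDiff {N : ℕ} {G r : Euc N → ℝ} (hG : LocallyIntegrable G volume)
    (hr : ContDiff ℝ 1 r) (hc : HasCompactSupport r) :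
    ContDiff ℝ 1 (fun x => ∫ z, G z * r (x - z)) :=
  hc.contDiff_convolution_right (ContinuousLinearMap.mul ℝ ℝ) hG hr

theorem aux_scaling {N : ℕ} {G r : Euc N → ℝ} (hG : LocallyIntegrable G volume)
    (hhom : ∀ c : ℝ, 0 < c → ∀ z, G (c • z) = c ^ ((2 : ℝ) - N) * G z)
    (hr : ContDiff ℝ 1 r) (hc : HasCompactSupport r) (x : Euc N) :
    ∫ z, G z * fderiv ℝ r (x - z) z = 2 * ∫ z, G z * r (x - z) := by
  set S : ℝ → ℝ := fun c => ∫ z, G z * r (x - c • z) with hS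
  have hS1 : ∀ c : ℝ, 0 < c → S c = c ^ (-2 : ℝ) * ∫ z, G z * r (x - z) := by
    intro c hcp
    have h1 := Measure.integral_comp_smul (volume : Measure (Euc N))
      (fun z => G z * r (x - z)) c
    simp only [hhom c hcp, mul_assoc, integral_const_mul, finrank_euclideanSpace,
      Fintype.card_fin, smul_eq_mul] at h1
    have h2 : c ^ ((2 : ℝ) - N) * S c = (c ^ N)⁻¹ * ∫ z, G z * r (x - z) := by
      rw [hS]; rw [h1, abs_of_pos (by positivity)]
    have h3 : (c ^ N)⁻¹ = c ^ ((2 : ℝ) - N) * c ^ (-2 : ℝ) := by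
      rw [← Real.rpow_add hcp, ← Real.rpow_natCast, ← Real.rpow_neg hcp.le]
      congr 1; ring
    rw [h3, mul_assoc] at h2
    exact mul_left_cancel₀ (by positivity) h2
  have hd1 : HasDerivAt S (-2 * ∫ z, G z * r (x - z)) 1 := by
    have : HasDerivAt (fun c : ℝ => c ^ (-2 : ℝ) * ∫ z, G z * r (x - z))
        (-2 * ∫ z, G z * r (x - z)) 1 := by
      have := (Real.hasDerivAt_rpow_const (x := 1) (p := -2) (by simp)).mul_const
        (∫ z, G z * r (x - z))
      simpa using this
    refine this.congr_of_eventuallyEq ?_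
    filter_upwards [lt_mem_nhds (show (0 : ℝ) < 1 by norm_num)] with c hcp using hS1 c hcp
  let f : ℝ → Euc N → ℝ := fun c w => r (x + c • w)
  obtain ⟨R, hR⟩ := hc.isCompact.isBounded.exists_norm_le
  have hfC : ContDiff ℝ 1 (↿f) := by
    have : ContDiff ℝ 1 (fun p : ℝ × Euc N => x + p.1 • p.2) := by fun_prop
    exact hr.comp this
  have hf0 : ∀ c w, c ∈ Metric.ball (1 : ℝ) (1/2) → w ∉ Metric.closedBall (0 : Euc N) (2 * (R + ‖x‖)) → f c w = 0 := by
    intro c w hcm hw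
    by_contra h0
    have h1 : ‖x + c • w‖ ≤ R := hR _ (subset_tsupport _ h0)
    have h2 : ‖c • w‖ ≤ R + ‖x‖ := by
      calc ‖c • w‖ = ‖(x + c • w) - x‖ := by congr 1; abel
        _ ≤ _ := norm_sub_le _ _
        _ ≤ _ := by linarith
    rw [norm_smul] at h2
    rw [Metric.mem_ball, Real.dist_eq, abs_lt] at hcm
    have h3 : (1/2 : ℝ) ≤ ‖c‖ := by
      rw [Real.norm_eq_abs]; exact le_trans (by linarith) (le_abs_self c)
    apply hw
    rw [mem_closedBall_zero_iff]
    nlinarith [norm_nonneg w]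
  have hd2 := hasFDerivAt_convolution_right_with_param (μ := volume) (ContinuousLinearMap.mul ℝ ℝ)
    Metric.isOpen_ball (isCompact_closedBall (0 : Euc N) (2 * (R + ‖x‖))) hf0 hG hfC.contDiffOn
    ((1 : ℝ), (0 : Euc N)) (by simp)
  have hline : HasDerivAt (fun c : ℝ => (c, (0 : Euc N))) ((1 : ℝ), (0 : Euc N)) 1 :=
    (hasDerivAt_id (1 : ℝ)).prodMk (hasDerivAt_const _ _)
  have hd3 := hd2.comp_hasDerivAt (1 : ℝ) hline
  have hfd : ∀ w, fderiv ℝ (↿f) (1, w) (1, 0) = fderiv ℝ r (x + w) w := by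
    intro w
    have h1 : HasDerivAt (fun c : ℝ => (c, w)) ((1 : ℝ), (0 : Euc N)) 1 :=
      (hasDerivAt_id (1 : ℝ)).prodMk (hasDerivAt_const _ _)
    have h2 : HasFDerivAt (↿f) (fderiv ℝ (↿f) ((1:ℝ), w)) ((1:ℝ), w) :=
      (hfC.differentiable one_ne_zero _).hasFDerivAt
    have h3 := h2.comp_hasDerivAt (1 : ℝ) h1
    have h4 : HasDerivAt (fun c : ℝ => x + c • w) w 1 := by
      simpa using ((hasDerivAt_id (1 : ℝ)).smul_const w).const_add x
    have h5 : HasFDerivAt r (fderiv ℝ r (x + w)) (x + (1 : ℝ) • w) := by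
      rw [one_smul]; exact (hr.differentiable one_ne_zero _).hasFDerivAt
    exact h3.unique (h5.comp_hasDerivAt (1 : ℝ) h4)
  rw [convolution_precompR_apply _ hG] at hd3
  · have hS' : S = fun c : ℝ => (convolution G (f c) (ContinuousLinearMap.mul ℝ ℝ) volume) (0 : Euc N) := by
      funext c
      simp only [hS, convolution, f]
      congr 1; funext z; simp [sub_eq_add_neg]
    rw [hS'] at hd1
    have h6 := hd1.unique hd3
    simp only [convolution, hfd] at h6
    simp only [zero_sub, map_neg, ContinuousLinearMap.mul_apply', ← sub_eq_add_neg, integral_neg] at h6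
    linarith
  · refine HasCompactSupport.intro (isCompact_closedBall (0 : Euc N) (2 * (R + ‖x‖))) ?_
    intro w hw
    have : (↿f) =ᶠ[𝓝 ((1 : ℝ), w)] fun _ => 0 := by
      have ho : IsOpen (Metric.ball (1 : ℝ) (1/2) ×ˢ (Metric.closedBall (0 : Euc N) (2 * (R + ‖x‖)))ᶜ) :=
        Metric.isOpen_ball.prod Metric.isClosed_closedBall.isOpen_compl
      filter_upwards [ho.mem_nhds ⟨by simp, hw⟩] with p hp using hf0 p.1 p.2 hp.1 hp.2
    rw [this.fderiv_eq]; simp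
  · exact (hfC.continuous_fderiv one_ne_zero).comp (by fun_prop)

theorem aux_symm {N : ℕ} {G r q : Euc N → ℝ} (hG : LocallyIntegrable G volume)
    (heven : ∀ z, G (-z) = G z)
    (hr : Continuous r) (hrc : HasCompactSupport r) (hq : Continuous q) (hqc : HasCompactSupport q) :
    ∫ x, r x * ∫ z, G z * q (x - z) = ∫ y, q y * ∫ z, G z * r (y - z) := by
  have hsub : ∀ (p : Euc N → ℝ) (x : Euc N), ∫ z, G z * p (x - z) = ∫ y, G (x - y) * p y := by
    intro p x
    have := integral_sub_left_eq_self (fun y => G (x - y) * p y) volume x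
    rw [← this]; simp
  obtain ⟨R1, hR1⟩ := hrc.isCompact.isBounded.exists_norm_le
  obtain ⟨R2, hR2⟩ := hqc.isCompact.isBounded.exists_norm_le
  obtain ⟨C, hC⟩ := hr.bounded_above_of_compact_support hrc
  set G' : Euc N → ℝ := (Metric.closedBall 0 (R1 + R2)).indicator G with hG'
  have hG'i : Integrable G' volume :=
    (hG.integrableOn_isCompact (isCompact_closedBall _ _)).integrable_indicator
      Metric.isClosed_closedBall.measurableSet
  have hqi : Integrable q volume := hq.integrable_of_hasCompactSupport hqc
  have h1 : Integrable (fun p : Euc N × Euc N => q p.2 * G' (p.1 - p.2)) (volume.prod volume) :=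
    hqi.convolution_integrand (ContinuousLinearMap.mul ℝ ℝ) hG'i
  have h2 : Integrable (fun p : Euc N × Euc N => r p.1 * (q p.2 * G' (p.1 - p.2)))
      (volume.prod volume) :=
    h1.bdd_mul (c := C) (hr.comp continuous_fst).aestronglyMeasurable
      (Eventually.of_forall fun p => hC p.1)
  have h3 : ∀ x y, r x * (q y * G' (x - y)) = r x * (G (x - y) * q y) := by
    intro x y
    by_cases hx : r x = 0
    · simp [hx]
    by_cases hy : q y = 0
    · simp [hy]
    have : x - y ∈ Metric.closedBall (0 : Euc N) (R1 + R2) := by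
      rw [mem_closedBall_zero_iff]
      exact (norm_sub_le _ _).trans (add_le_add (hR1 _ (subset_tsupport _ hx)) (hR2 _ (subset_tsupport _ hy)))
    rw [hG', Set.indicator_of_mem this]; ring
  have h4 := integral_integral_swap (f := fun x y => r x * (q y * G' (x - y))) h2
  simp only [h3] at h4
  simp only [hsub, ← integral_const_mul]
  rw [h4]
  congr 1; funext y; congr 1; funext x
  rw [← heven (x - y), neg_sub]; ring

theorem aux_sum {N : ℕ} (L : Euc N →L[ℝ] ℝ) (x : Euc N) :
    ∑ j, x j * L (EuclideanSpace.single j 1) = L x := by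
  conv_rhs => rw [← (EuclideanSpace.basisFun (Fin N) ℝ).sum_repr x]
  simp [map_sum]

theorem aux_ibp {N : ℕ} {f h : Euc N → ℝ} (hf : ContDiff ℝ 1 f) (hfc : HasCompactSupport f)
    (hh : ContDiff ℝ 1 h) (v : Euc N) :
    ∫ x, fderiv ℝ f x v * h x = - ∫ x, f x * fderiv ℝ h x v := by
  have c1 : Continuous (fun x => fderiv ℝ f x v) :=
    (hf.continuous_fderiv one_ne_zero).clm_apply continuous_const
  have c2 : Continuous (fun x => fderiv ℝ h x v) :=
    (hh.continuous_fderiv one_ne_zero).clm_apply continuous_const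
  have s1 : HasCompactSupport (fun x => fderiv ℝ f x v) := hfc.fderiv_apply ℝ v
  rw [integral_mul_fderiv_eq_neg_fderiv_mul_of_integrable, neg_neg]
  · exact (c1.mul hh.continuous).integrable_of_hasCompactSupport s1.mul_right
  · exact (hf.continuous.mul c2).integrable_of_hasCompactSupport hfc.mul_right
  · exact (hf.continuous.mul hh.continuous).integrable_of_hasCompactSupport hfc.mul_right
  · exact fun x _ => hf.differentiable one_ne_zero x
  · exact fun x _ => hh.differentiable one_ne_zero x

theorem aux_coord {N : ℕ} (j : Fin N) : ContDiff ℝ 1 (fun x : Euc N => x j) :=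
  (EuclideanSpace.proj (𝕜 := ℝ) j).contDiff

theorem aux_coord_fderiv {N : ℕ} (j : Fin N) (x v : Euc N) :
    fderiv ℝ (fun x : Euc N => x j) x v = v j := by
  have h2 : HasFDerivAt (fun x : Euc N => x j) (EuclideanSpace.proj (𝕜 := ℝ) j : Euc N →L[ℝ] ℝ) x :=
    (EuclideanSpace.proj (𝕜 := ℝ) j : Euc N →L[ℝ] ℝ).hasFDerivAt
  rw [h2.fderiv]; rfl

theorem aux_virial {N : ℕ} {G r : Euc N → ℝ} (hG : LocallyIntegrable G volume)
    (heven : ∀ z, G (-z) = G z)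
    (hhom : ∀ c : ℝ, 0 < c → ∀ z, G (c • z) = c ^ ((2 : ℝ) - N) * G z)
    (hr : ContDiff ℝ 1 r) (hc : HasCompactSupport r) {ψ : Euc N → ℝ}
    (hψ : ψ = fun x => ∫ z, G z * r (x - z)) :
    ∫ x, r x * fderiv ℝ ψ x x = -(((N : ℝ) - 2) / 2) * ∫ x, r x * ψ x := by
  have hψC : ContDiff ℝ 1 ψ := hψ ▸ aux_conv_contDiff hG hr hc
  set q : Euc N → ℝ := fun y => fderiv ℝ r y y with hq
  have hqcont : Continuous q := (hr.continuous_fderiv one_ne_zero).clm_apply continuous_id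
  have hqc : HasCompactSupport q := by
    refine (hc.fderiv ℝ).mono ?_
    intro y hy h0
    apply hy
    simp only [hq]
    rw [h0]; simp
  have hpt : ∀ x, fderiv ℝ ψ x x = 2 * ψ x + ∫ z, G z * q (x - z) := by
    intro x
    obtain ⟨L, hL1, hL2⟩ := aux_conv_deriv hG hr hc x
    rw [← hψ] at hL1
    rw [hL1.fderiv, hL2, hψ]
    simp only
    rw [← aux_scaling hG hhom hr hc x]
    have i2 := aux_conv_int hG hqcont hqc x
    have i1 : Integrable (fun z => G z * fderiv ℝ r (x - z) x) :=
      aux_conv_int (r := fun y => fderiv ℝ r y x) hG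
        ((hr.continuous_fderiv one_ne_zero).clm_apply continuous_const) (hc.fderiv_apply ℝ x) x
    have i3 : (fun z => G z * fderiv ℝ r (x - z) z) =
        fun z => G z * fderiv ℝ r (x - z) x - G z * q (x - z) := by
      funext z; simp only [hq, map_sub]; ring
    rw [i3, integral_sub i1 i2]; ring
  have hψcont := hψC.continuous
  have hdψ : Continuous (fun x => fderiv ℝ ψ x x) :=
    (hψC.continuous_fderiv one_ne_zero).clm_apply continuous_id
  have iB : Integrable (fun x => r x * ψ x) :=
    (hr.continuous.mul hψcont).integrable_of_hasCompactSupport hc.mul_right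
  have iY : Integrable (fun x => r x * fderiv ℝ ψ x x) :=
    (hr.continuous.mul hdψ).integrable_of_hasCompactSupport hc.mul_right
  have iX : Integrable (fun x => r x * ∫ z, G z * q (x - z)) :=
    (hr.continuous.mul (aux_conv_cont hG hqcont hqc)).integrable_of_hasCompactSupport hc.mul_right
  have e1 : ∫ x, r x * fderiv ℝ ψ x x = 2 * (∫ x, r x * ψ x) + ∫ x, q x * ψ x := by
    have := aux_symm hG heven hr.continuous hc hqcont hqc
    rw [show (∫ x, q x * ψ x) = ∫ y, q y * ∫ z, G z * r (y - z) by rw [hψ], ← this,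
      ← integral_const_mul, ← integral_add (iB.const_mul 2) iX]
    congr 1; funext x; rw [hpt]; ring
  have e2 : ∫ x, q x * ψ x = - (N * ∫ x, r x * ψ x) - ∫ x, r x * fderiv ℝ ψ x x := by
    have hj : ∀ j : Fin N, ∫ x, fderiv ℝ r x (EuclideanSpace.single j 1) * (x j * ψ x) =
        - ∫ x, (r x * ψ x + r x * (x j * fderiv ℝ ψ x (EuclideanSpace.single j 1))) := by
      intro j
      rw [aux_ibp hr hc ((aux_coord j).mul hψC)]
      congr 2; funext x
      have : fderiv ℝ (fun x : Euc N => x j * ψ x) x (EuclideanSpace.single j 1) =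
          ψ x + x j * fderiv ℝ ψ x (EuclideanSpace.single j 1) := by
        rw [fderiv_fun_mul ((aux_coord j).differentiable one_ne_zero x) (hψC.differentiable one_ne_zero x)]
        simp [aux_coord_fderiv]; ring
      rw [this]; ring
    have c1 : ∀ j : Fin N, Continuous (fun x => fderiv ℝ r x (EuclideanSpace.single j 1)) :=
      fun j => (hr.continuous_fderiv one_ne_zero).clm_apply continuous_const
    have c2 : ∀ j : Fin N, Continuous (fun x => fderiv ℝ ψ x (EuclideanSpace.single j 1)) :=
      fun j => (hψC.continuous_fderiv one_ne_zero).clm_apply continuous_const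
    have i1 : ∀ j : Fin N, Integrable (fun x : Euc N => fderiv ℝ r x (EuclideanSpace.single j 1) * (x j * ψ x)) :=
      fun j => ((c1 j).mul ((aux_coord j).continuous.mul hψcont)).integrable_of_hasCompactSupport
        (hc.fderiv_apply ℝ _).mul_right
    have i2 : ∀ j : Fin N, Integrable (fun x : Euc N => r x * (x j * fderiv ℝ ψ x (EuclideanSpace.single j 1))) :=
      fun j => (hr.continuous.mul ((aux_coord j).continuous.mul (c2 j))).integrable_of_hasCompactSupport
        hc.mul_right
    have s1 : ∫ x, q x * ψ x = ∑ j, ∫ x, fderiv ℝ r x (EuclideanSpace.single j 1) * (x j * ψ x) := by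
      rw [← integral_finsetSum _ (fun j _ => i1 j)]
      congr 1; funext x
      simp only [hq]
      rw [← aux_sum, Finset.sum_mul]
      refine Finset.sum_congr rfl fun j _ => by ring
    have s2 : ∫ x, r x * fderiv ℝ ψ x x = ∑ j, ∫ x, r x * (x j * fderiv ℝ ψ x (EuclideanSpace.single j 1)) := by
      rw [← integral_finsetSum _ (fun j _ => i2 j)]
      congr 1; funext x
      rw [← Finset.mul_sum, aux_sum]
    rw [s1, s2]
    simp only [hj, integral_add iB (i2 _)]
    rw [Finset.sum_neg_distrib, Finset.sum_add_distrib]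
    simp; ring
  linarith

theorem aux_green_even {N : ℕ} (z : Euc N) : green N (-z) = green N z := by
  simp [green]

theorem aux_green_hom {N : ℕ} (hN : 4 ≤ N) (c : ℝ) (hc : 0 < c) (z : Euc N) :
    green N (c • z) = c ^ ((2 : ℝ) - N) * green N z := by
  have : N ≠ 2 := by omega
  simp only [green, this, if_false, norm_smul, Real.norm_eq_abs, abs_of_pos hc]
  rw [Real.mul_rpow hc.le (norm_nonneg _)]; ring

theorem aux_green_loc {N : ℕ} (hN : 4 ≤ N) : LocallyIntegrable (green N) volume := by
  have h2 : N ≠ 2 := by omega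
  refine locallyIntegrable_of_norm_le_rpow (C := 1) (α := (N : ℝ) - 2) ?_ ?_ ?_ ?_
  · simp; omega
  · simp
  · refine Eventually.of_forall fun x => ?_
    simp only [green, h2, if_false, norm_neg, neg_sub, one_mul]
    rw [Real.norm_of_nonneg (by positivity)]
  · have : green N = fun x : Euc N => -(‖x‖ ^ ((2 : ℝ) - (N : ℝ))) := by
      funext x; simp [green, h2]
    rw [this]
    exact ((measurable_norm.pow_const _).neg).aestronglyMeasurable

theorem aux_dt {N : ℕ} {Ω : Set (Euc N)} (hΩo : IsOpen Ω) (hΩb : Bornology.IsBounded Ω)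
    {f : ℝ → Euc N → ℝ} (hf : ContDiff ℝ 1 (fun p : ℝ × Euc N => f p.1 p.2))
    (h0 : ∀ t, 0 ≤ t → ∀ x, x ∉ Ω → f t x = 0) (t : ℝ) (ht : 0 < t) :
    HasDerivAt (fun t => ∫ x in Ω, f t x) (∫ x, deriv (fun s => f s x) t) t := by
  have hcl : IsCompact (closure Ω) := hΩb.isCompact_closure
  have hfin : volume Ω < ⊤ := hΩb.measure_lt_top
  have hder : ∀ s x, HasDerivAt (fun s => f s x)
      (fderiv ℝ (fun p : ℝ × Euc N => f p.1 p.2) (s, x) (1, 0)) s := by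
    intro s x
    have h1 : HasDerivAt (fun c : ℝ => (c, x)) ((1 : ℝ), (0 : Euc N)) s :=
      (hasDerivAt_id s).prodMk (hasDerivAt_const _ _)
    exact (hf.differentiable one_ne_zero (s, x)).hasFDerivAt.comp_hasDerivAt s h1
  have hdc : Continuous (fun p : ℝ × Euc N =>
      fderiv ℝ (fun p : ℝ × Euc N => f p.1 p.2) p (1, 0)) :=
    (hf.continuous_fderiv one_ne_zero).clm_apply continuous_const
  have hslice : ∀ s, Continuous (f s) := fun s =>
    hf.continuous.comp (by fun_prop : Continuous fun x : Euc N => (s, x))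
  obtain ⟨C, hC⟩ := ((isCompact_closedBall t 1).prod hcl).exists_bound_of_continuousOn hdc.continuousOn
  have key := hasDerivAt_integral_of_dominated_loc_of_deriv_le (μ := volume.restrict Ω)
    (F := f) (F' := fun s x => fderiv ℝ (fun p : ℝ × Euc N => f p.1 p.2) (s, x) (1, 0))
    (x₀ := t) (s := Metric.ball t 1) (bound := fun _ => C)
    (Metric.ball_mem_nhds t one_pos)
    (Eventually.of_forall fun s => (hslice s).aestronglyMeasurable)
    (((hslice t).continuousOn.integrableOn_compact hcl).mono_set subset_closure)
    (hdc.comp (by fun_prop : Continuous fun x : Euc N => (t, x))).aestronglyMeasurable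
    (by
      filter_upwards [ae_restrict_mem hΩo.measurableSet] with x hx s hs
      exact hC (s, x) ⟨Metric.ball_subset_closedBall hs, subset_closure hx⟩)
    (integrableOn_const hfin.ne)
    (Eventually.of_forall fun x s _ => hder s x)
  have h1 := key.2
  have h2 : ∫ x in Ω, fderiv ℝ (fun p : ℝ × Euc N => f p.1 p.2) (t, x) (1, 0) =
      ∫ x, deriv (fun s => f s x) t := by
    simp only [(hder t _).deriv]
    apply setIntegral_eq_integral_of_forall_compl_eq_zero
    intro x hx
    rw [← (hder t x).deriv]
    have : (fun s => f s x) =ᶠ[𝓝 t] fun _ => 0 := by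
      filter_upwards [lt_mem_nhds ht] with s hs using h0 s hs.le x hx
    rw [this.deriv_eq]; simp
  rw [← h2]; exact h1

theorem aux_normsq_fderiv {N : ℕ} (x : Euc N) (i : Fin N) :
    fderiv ℝ (fun y : Euc N => ‖y‖ ^ 2) x (EuclideanSpace.single i 1) = 2 * x i := by
  rw [fderiv_norm_sq_apply]
  simp [EuclideanSpace.inner_single_right]

theorem aux_mass {N : ℕ} {r : Euc N → ℝ} {v : Euc N → Euc N} (hr : ContDiff ℝ 1 r)
    (hc : HasCompactSupport r) (hv : ∀ i, ContDiff ℝ 1 (fun x => v x i)) :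
    ∫ x, ediv (fun y => r y • v y) x * ‖x‖ ^ 2 = - (2 * ∫ x, ∑ i, r x * v x i * x i) := by
  have hf : ∀ i, ContDiff ℝ 1 (fun x => r x * v x i) := fun i => hr.mul (hv i)
  have hfc : ∀ i, HasCompactSupport (fun x => r x * v x i) := fun i => hc.mul_right
  have hn : ContDiff ℝ 1 (fun y : Euc N => ‖y‖ ^ 2) := contDiff_norm_sq ℝ
  have i1 : ∀ i, Integrable (fun x => fderiv ℝ (fun x => r x * v x i) x (EuclideanSpace.single i 1) * ‖x‖ ^ 2) :=
    fun i => ((((hf i).continuous_fderiv one_ne_zero).clm_apply continuous_const).mul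
      hn.continuous).integrable_of_hasCompactSupport ((hfc i).fderiv_apply ℝ _).mul_right
  have i2 : ∀ i, Integrable (fun x : Euc N => r x * v x i * x i) :=
    fun i => ((hf i).continuous.mul (aux_coord i).continuous).integrable_of_hasCompactSupport (hfc i).mul_right
  simp only [ediv, PiLp.smul_apply, smul_eq_mul, Finset.sum_mul]
  rw [integral_finsetSum _ (fun i _ => i1 i), integral_finsetSum _ (fun i _ => i2 i),
    Finset.mul_sum, ← Finset.sum_neg_distrib]
  refine Finset.sum_congr rfl fun i _ => ?_
  rw [aux_ibp (hf i) (hfc i) hn, ← integral_const_mul]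
  congr 2; funext x
  rw [aux_normsq_fderiv]; ring

theorem aux_ibp_coord {N : ℕ} {f : Euc N → ℝ} (hf : ContDiff ℝ 1 f) (hfc : HasCompactSupport f)
    (i j : Fin N) :
    Integrable (fun x => epartial i f x * x j) ∧
    ∫ x, epartial i f x * x j = if i = j then - ∫ x, f x else 0 := by
  constructor
  · exact (((hf.continuous_fderiv one_ne_zero).clm_apply continuous_const).mul
      (aux_coord j).continuous).integrable_of_hasCompactSupport (hfc.fderiv_apply ℝ _).mul_right
  · simp only [epartial]
    rw [aux_ibp hf hfc (aux_coord j)]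
    simp only [aux_coord_fderiv]
    split_ifs with h
    · subst h; simp
    · simp [Ne.symm h]

theorem aux_final {H M : ℝ → ℝ} {M' : ℝ → ℝ} {c : ℝ} (hc : 0 < c)
    (hH : ∀ t, 0 < t → HasDerivAt H (2 * M t) t)
    (hM : ∀ t, 0 < t → HasDerivAt M (M' t) t) (hM' : ∀ t, 0 < t → M' t ≤ -c)
    (hpos : ∀ t, 0 < t → 0 ≤ H t) : False := by
  have hcv : Convex ℝ (Set.Ici (1 : ℝ)) := convex_Ici 1
  have gen : ∀ {F F' : ℝ → ℝ}, (∀ t, 0 < t → HasDerivAt F (F' t) t) →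
      (∀ t, 1 ≤ t → F' t ≤ 0) → ∀ t, 1 ≤ t → F t ≤ F 1 := by
    intro F F' h1 h2 t ht
    have : AntitoneOn F (Set.Ici (1 : ℝ)) := by
      refine antitoneOn_of_deriv_nonpos hcv ?_ ?_ ?_
      · intro s hs
        exact (h1 s (lt_of_lt_of_le one_pos hs)).continuousAt.continuousWithinAt
      · intro s hs
        rw [interior_Ici] at hs
        exact (h1 s (lt_trans one_pos hs)).differentiableAt.differentiableWithinAt
      · intro s hs
        rw [interior_Ici] at hs
        rw [(h1 s (lt_trans one_pos hs)).deriv]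
        exact h2 s (le_of_lt hs)
    exact this (Set.mem_Ici.2 le_rfl) ht ht
  have a1 : ∀ t, 1 ≤ t → M t + c * t ≤ M 1 + c * 1 := by
    refine gen (F := fun t => M t + c * t) (F' := fun t => M' t + c * 1) ?_ ?_
    · intro t ht
      exact (hM t ht).add ((hasDerivAt_id t).const_mul c)
    · intro t ht
      have := hM' t (by linarith)
      linarith
  have a2 : ∀ t, 1 ≤ t → H t - 2 * (M 1 + c) * t + c * t ^ 2 ≤ H 1 - 2 * (M 1 + c) * 1 + c * 1 ^ 2 := by
    refine gen (F := fun t => H t - 2 * (M 1 + c) * t + c * t ^ 2)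
      (F' := fun t => 2 * M t - 2 * (M 1 + c) * 1 + c * (2 * t)) ?_ ?_
    · intro t ht
      have h3 : HasDerivAt (fun t : ℝ => c * t ^ 2) (c * (2 * t)) t := by
        simpa using (hasDerivAt_pow 2 t).const_mul c
      exact ((hH t ht).sub ((hasDerivAt_id t).const_mul _)).add h3
    · intro t ht
      have := a1 t ht
      linarith
  set A := |2 * (M 1 + c)| with hA
  set B := |H 1 - 2 * (M 1 + c) * 1 + c * 1 ^ 2| with hB
  have hA0 : 0 ≤ A := abs_nonneg _
  have hB0 : 0 ≤ B := abs_nonneg _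
  set t := 1 + (A + B) / c with ht
  have h1 : 1 ≤ t := by rw [ht]; have : 0 ≤ (A + B) / c := by positivity
                        linarith
  have h2 := a2 t h1
  have h3 := hpos t (by linarith)
  have h4 : 2 * (M 1 + c) ≤ A := le_abs_self _
  have h5 : H 1 - 2 * (M 1 + c) * 1 + c * 1 ^ 2 ≤ B := le_abs_self _
  have h6 : c * t = c + A + B := by rw [ht]; field_simp; ring
  have h7 : c * t ^ 2 = (c + A + B) * t := by rw [← h6]; ring
  nlinarith [mul_le_mul_of_nonneg_right h4 (by linarith : (0:ℝ) ≤ t), mul_nonneg hB0 (by linarith : (0:ℝ) ≤ t - 1), mul_pos hc (by linarith : (0:ℝ) < t)]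

theorem aux_lin {N : ℕ} {f₁ f₂ f₃ F : Euc N → ℝ} (h₁ : Integrable f₁) (h₂ : Integrable f₂)
    (h₃ : Integrable f₃) (a b c : ℝ) (hF : ∀ x, F x = a * f₁ x + b * f₂ x + c * f₃ x) :
    ∫ x, F x = a * (∫ x, f₁ x) + b * (∫ x, f₂ x) + c * ∫ x, f₃ x := by
  have h12 : Integrable (fun x => a * f₁ x + b * f₂ x) := (h₁.const_mul a).add (h₂.const_mul b)
  simp only [hF]
  rw [integral_add h12 (h₃.const_mul c), integral_add (h₁.const_mul a) (h₂.const_mul b),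
    integral_const_mul, integral_const_mul, integral_const_mul]

/-- For `N ≥ 4` and `1 < γ ≤ 2(N-1)/N`, there is no global
classical solution of the Euler–Poisson equations without damping whose
conserved total energy satisfies `E < 0`. -/
theorem blowup_negative_energy (N : ℕ) (hN : 4 ≤ N) (K γ g : ℝ)
    (hK : 0 < K) (hg : 0 < g) (hγ1 : 1 < γ) (hγ2 : γ ≤ 2 * ((N : ℝ) - 1) / N)
    (Ω : Set (Euc N)) (ρ : ℝ → Euc N → ℝ) (u : ℝ → Euc N → Euc N)
    (hsol : IsEPSolution N K γ 0 g Ω ⊤ ρ u)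
    (E : ℝ) (hE : ∀ t : ℝ, 0 ≤ t → energy N K γ g Ω ρ u t = E)
    (hEneg : E < 0) :
    False := by
  have hN4 : (4 : ℝ) ≤ N := by exact_mod_cast hN
  have hr : ∀ t, ContDiff ℝ 1 (ρ t) := fun t =>
    hsol.rho_C1.comp (by fun_prop : ContDiff ℝ 1 fun x : Euc N => (t, x))
  have hucj : ∀ j, ContDiff ℝ 1 (fun p : ℝ × Euc N => u p.1 p.2 j) := fun j =>
    (aux_coord j).comp hsol.u_C1
  have hv : ∀ t j, ContDiff ℝ 1 (fun x => u t x j) := fun t j =>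
    (hucj j).comp (by fun_prop : ContDiff ℝ 1 fun x : Euc N => (t, x))
  have hz : ∀ t, 0 ≤ t → ∀ x, x ∉ Ω → ρ t x = 0 := by
    intro t ht x hx
    by_contra h
    exact hx (hsol.support_subset t ht (EReal.coe_lt_top t) h)
  have hcs : ∀ t, 0 ≤ t → HasCompactSupport (ρ t) := fun t ht =>
    HasCompactSupport.of_support_subset_isCompact hsol.omega_bounded.isCompact_closure
      ((hsol.support_subset t ht (EReal.coe_lt_top t)).trans subset_closure)
  have hcoord : ∀ j, ContDiff ℝ 1 (fun p : ℝ × Euc N => p.2 j) := fun j =>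
    (aux_coord j).comp contDiff_snd
  let M : ℝ → ℝ := fun t => ∫ x in Ω, ∑ j, ρ t x * u t x j * x j
  -- derivative of the inertia
  have hH : ∀ t, 0 < t → HasDerivAt (inertia N Ω ρ) (2 * M t) t := by
    intro t ht
    have h1 := aux_dt hsol.omega_open hsol.omega_bounded (f := fun t x => ρ t x * ‖x‖ ^ 2)
      (hsol.rho_C1.mul (contDiff_snd.norm_sq ℝ)) (fun t ht x hx => by simp [hz t ht x hx]) t ht
    have h2 : ∫ x, deriv (fun s => ρ s x * ‖x‖ ^ 2) t = 2 * M t := by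
      have h3 : ∀ x, deriv (fun s => ρ s x * ‖x‖ ^ 2) t =
          - (ediv (fun y => ρ t y • u t y) x * ‖x‖ ^ 2) := by
        intro x
        have hd : DifferentiableAt ℝ (fun s => ρ s x) t :=
          (hsol.rho_C1.comp (by fun_prop : ContDiff ℝ 1 fun s : ℝ => (s, x))).differentiable
            one_ne_zero t
        rw [deriv_mul_const hd]
        have := hsol.continuity_eq t ht.le (EReal.coe_lt_top t) x
        rw [eq_neg_of_add_eq_zero_left this]; ring
      simp only [h3]
      rw [integral_neg, aux_mass (hr t) (hcs t ht.le) (hv t), neg_neg]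
      congr 1
      symm
      apply setIntegral_eq_integral_of_forall_compl_eq_zero
      intro x hx
      simp [hz t ht.le x hx]
    rw [h2] at h1
    exact h1
  let A : ℝ → ℝ := fun t => ∫ x, ρ t x * ‖u t x‖ ^ 2
  let Q : ℝ → ℝ := fun t => ∫ x, K * ρ t x ^ γ
  let W : ℝ → ℝ := fun t => ∫ x, ρ t x * potential N g ρ t x
  have hγ0 : γ ≠ 0 := by linarith
  have hP : ∀ t, ContDiff ℝ 1 (fun x => K * ρ t x ^ γ) := fun t => by
    have : ContDiff ℝ ((1 : ℕ) : WithTop ℕ∞) (fun x => ρ t x ^ γ) :=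
      ContDiff.rpow_const_of_le (by exact_mod_cast hr t) (by simpa using hγ1.le)
    exact contDiff_const.mul (by exact_mod_cast this)
  have hPc : ∀ t, 0 ≤ t → HasCompactSupport (fun x => K * ρ t x ^ γ) := fun t ht => by
    refine (hcs t ht).mono ?_
    intro x hx h0
    apply hx
    simp [h0, Real.zero_rpow hγ0]
  have hpot : ∀ t, potential N g ρ t = fun x => g * ∫ z, green N z * ρ t (x - z) := by
    intro t; funext x
    simp only [potential]
    congr 1
    have := integral_sub_left_eq_self (fun y => green N (x - y) * ρ t y) volume x
    rw [← this]; simp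
  have hψC : ∀ t, 0 ≤ t → ContDiff ℝ 1 (fun x => ∫ z, green N z * ρ t (x - z)) := fun t ht =>
    aux_conv_contDiff (aux_green_loc hN) (hr t) (hcs t ht)
  have hpotC : ∀ t, 0 ≤ t → ContDiff ℝ 1 (potential N g ρ t) := fun t ht => by
    rw [hpot]; exact contDiff_const.mul (hψC t ht)
  have hvir : ∀ t, 0 ≤ t → ∫ x, ρ t x * fderiv ℝ (potential N g ρ t) x x =
      -(((N : ℝ) - 2) / 2) * W t := by
    intro t ht
    have h1 := aux_virial (aux_green_loc hN) aux_green_even (aux_green_hom hN) (hr t) (hcs t ht) rfl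
    have h2 : ∀ x, ρ t x * fderiv ℝ (potential N g ρ t) x x =
        g * (ρ t x * fderiv ℝ (fun x => ∫ z, green N z * ρ t (x - z)) x x) := by
      intro x
      rw [hpot, fderiv_const_mul ((hψC t ht).differentiable one_ne_zero x)]
      simp; ring
    simp only [h2, integral_const_mul, h1, W]
    have h3 : ∀ x, ρ t x * potential N g ρ t x =
        g * (ρ t x * ∫ z, green N z * ρ t (x - z)) := by
      intro x; rw [hpot]; ring
    simp only [h3, integral_const_mul]; ring
  have iA : ∀ t, 0 ≤ t → Integrable (fun x => ρ t x * ‖u t x‖ ^ 2) := fun t ht => by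
    have hu : Continuous (u t) := hsol.u_C1.continuous.comp
      (by fun_prop : Continuous fun x : Euc N => (t, x))
    exact ((hr t).continuous.mul (hu.norm.pow 2)).integrable_of_hasCompactSupport (hcs t ht).mul_right
  have iQ : ∀ t, 0 ≤ t → Integrable (fun x => K * ρ t x ^ γ) := fun t ht =>
    (hP t).continuous.integrable_of_hasCompactSupport (hPc t ht)
  have iW : ∀ t, 0 ≤ t → Integrable (fun x => ρ t x * potential N g ρ t x) := fun t ht =>
    ((hr t).continuous.mul (hpotC t ht).continuous).integrable_of_hasCompactSupport
      (hcs t ht).mul_right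
  have hen : ∀ t, 0 ≤ t → E = 1 / 2 * A t + Q t / (γ - 1) + 1 / 2 * W t := by
    intro t ht
    rw [← hE t ht, energy, setIntegral_eq_integral_of_forall_compl_eq_zero]
    · rw [aux_lin (iA t ht) (iQ t ht) (iW t ht) (1 / 2) (1 / (γ - 1)) (1 / 2) (fun x => by ring)]
      simp only [A, Q, W]; ring
    · intro x hx
      simp [hz t ht x hx, Real.zero_rpow hγ0]
  have hM : ∀ t, 0 < t → HasDerivAt M (A t + N * Q t + ((N : ℝ) - 2) / 2 * W t) t := by
    intro t ht
    have ht0 := ht.le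
    have h1 := aux_dt hsol.omega_open hsol.omega_bounded
      (f := fun t x => ∑ j, ρ t x * u t x j * x j)
      (ContDiff.sum fun j _ => (hsol.rho_C1.mul (hucj j)).mul (hcoord j))
      (fun t ht x hx => by simp [hz t ht x hx]) t ht
    have h2 : ∫ x, deriv (fun s => ∑ j, ρ s x * u s x j * x j) t =
        A t + N * Q t + ((N : ℝ) - 2) / 2 * W t := by
      have hd : ∀ x j, DifferentiableAt ℝ (fun s => ρ s x * u s x j) t := fun x j =>
        ((hsol.rho_C1.mul (hucj j)).comp
          (by fun_prop : ContDiff ℝ 1 fun s : ℝ => (s, x))).differentiable one_ne_zero t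
      have h3 : ∀ x, deriv (fun s => ∑ j, ρ s x * u s x j * x j) t =
          (- ∑ j, ∑ i, epartial i (fun y => ρ t y * u t y i * u t y j) x * x j)
          - (∑ j, epartial j (fun y => K * ρ t y ^ γ) x * x j)
          - ρ t x * fderiv ℝ (potential N g ρ t) x x := by
        intro x
        rw [deriv_fun_sum (fun j _ => (hd x j).mul_const _), ← aux_sum, Finset.mul_sum,
          ← Finset.sum_neg_distrib, ← Finset.sum_sub_distrib, ← Finset.sum_sub_distrib]
        refine Finset.sum_congr rfl fun j _ => ?_
        rw [deriv_mul_const (hd x j), ← Finset.sum_mul]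
        have := hsol.momentum_eq t ht0 (EReal.coe_lt_top t) x j
        have h4 : deriv (fun s => ρ s x * u s x j) t =
            - (∑ i, epartial i (fun y => ρ t y * u t y i * u t y j) x)
            - epartial j (fun y => K * ρ t y ^ γ) x
            - ρ t x * epartial j (potential N g ρ t) x := by linarith
        rw [h4]
        simp only [epartial]; ring
      have f1 : ∀ i j, ContDiff ℝ 1 (fun y => ρ t y * u t y i * u t y j) := fun i j =>
        ((hr t).mul (hv t i)).mul (hv t j)
      have f2 : ∀ i j, HasCompactSupport (fun y => ρ t y * u t y i * u t y j) := fun i j =>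
        (hcs t ht0).mul_right.mul_right
      have i1 : ∀ j i, Integrable (fun x => epartial i (fun y => ρ t y * u t y i * u t y j) x * x j) :=
        fun j i => (aux_ibp_coord (f1 i j) (f2 i j) i j).1
      have i2 : ∀ j, Integrable (fun x : Euc N => epartial j (fun y => K * ρ t y ^ γ) x * x j) :=
        fun j => (aux_ibp_coord (hP t) (hPc t ht0) j j).1
      have i3 : Integrable (fun x => ρ t x * fderiv ℝ (potential N g ρ t) x x) :=
        ((hr t).continuous.mul (((hpotC t ht0).continuous_fderiv one_ne_zero).clm_apply
          continuous_id)).integrable_of_hasCompactSupport (hcs t ht0).mul_right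
      have I1 : Integrable (fun x => ∑ j, ∑ i, epartial i (fun y => ρ t y * u t y i * u t y j) x * x j) :=
        integrable_finsetSum _ fun j _ => integrable_finsetSum _ fun i _ => i1 j i
      have I2 : Integrable (fun x : Euc N => ∑ j, epartial j (fun y => K * ρ t y ^ γ) x * x j) :=
        integrable_finsetSum _ fun j _ => i2 j
      have v1 : ∫ x, ∑ j, ∑ i, epartial i (fun y => ρ t y * u t y i * u t y j) x * x j = - A t := by
        rw [integral_finsetSum _ fun j _ => integrable_finsetSum _ fun i _ => i1 j i]
        have : ∀ j, ∫ x, ∑ i, epartial i (fun y => ρ t y * u t y i * u t y j) x * x j =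
            - ∫ x, ρ t x * u t x j * u t x j := by
          intro j
          rw [integral_finsetSum _ fun i _ => i1 j i]
          simp only [(aux_ibp_coord (f1 _ j) (f2 _ j) _ j).2]
          simp
        simp only [this]
        rw [Finset.sum_neg_distrib, ← integral_finsetSum _ fun j _ =>
          (f1 j j).continuous.integrable_of_hasCompactSupport (f2 j j)]
        congr 2; funext x
        rw [EuclideanSpace.real_norm_sq_eq, Finset.mul_sum]
        refine Finset.sum_congr rfl fun j _ => by ring
      have v2 : ∫ x : Euc N, ∑ j, epartial j (fun y => K * ρ t y ^ γ) x * x j = - (N * Q t) := by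
        rw [integral_finsetSum _ fun j _ => i2 j]
        simp only [(aux_ibp_coord (hP t) (hPc t ht0) _ _).2]
        simp [Q]
      rw [aux_lin I1 I2 i3 (-1) (-1) (-1) (fun x => by rw [h3]; ring), v1, v2, hvir t ht0]
      ring
    rw [h2] at h1
    exact h1
  have hc : 0 < -(((N : ℝ) - 2) * E) := by nlinarith
  refine aux_final hc hH hM ?_ ?_
  · intro t ht
    have hA0 : 0 ≤ A t := integral_nonneg fun x => mul_nonneg (hsol.rho_nonneg t x) (by positivity)
    have hQ0 : 0 ≤ Q t := integral_nonneg fun x =>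
      mul_nonneg hK.le (Real.rpow_nonneg (hsol.rho_nonneg t x) _)
    have hγp : 0 < γ - 1 := by linarith
    have h1 : γ * N ≤ 2 * ((N : ℝ) - 1) := (le_div_iff₀ (by linarith)).1 hγ2
    rw [hen t ht.le]
    have h2 : N * Q t ≤ ((N : ℝ) - 2) * (Q t / (γ - 1)) := by
      rw [← mul_div_assoc, le_div_iff₀ hγp]
      nlinarith
    nlinarith
  · intro t ht
    exact integral_nonneg fun x => mul_nonneg (hsol.rho_nonneg t x) (by positivity)
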